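/- arXiv:2603.07242 — 2 statements merged into one kernel-verified Lean document; each statement's English description precedes it below -/
import Mathlib

section
/- Let (Ω₁, μ₁) and (Ω₂, μ₂) be measure spaces, let 1 < p < ∞ with conjugate exponent p′ (1/p + 1/p′ = 1), and let 1 ≤ q < ∞. Let E ⊆ Lᵖ(Ω₁, μ₁) be a nonempty compact subset (in the Lᵖ norm topology), and let η : ℝ → ℝ be continuous and not a polynomial on any nonempty open interval. Then for every continuous map 𝓕 : E → L^q(Ω₂, μ₂) and every ε > 0 there exist m ∈ ℕ, functions φ_1,…,φ_m ∈ L^{p′}(Ω₁, μ₁), reals θ_1,…,θ_m, and functions g_1,…,g_m ∈ L^q(Ω₂, μ₂) such that sup_{f ∈ E} ‖𝓕(f) − Σ_{j=1}^m η(∫_{Ω₁} f(s) φ_j(s) dμ₁(s) − θ_j) • g_j‖_{L^q} < ε. -/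
open MeasureTheory

/-- `η` is not equal to any polynomial on any nonempty open interval of `ℝ`. -/
def NotPolynomialOnAnyInterval (η : ℝ → ℝ) : Prop :=
  ∀ (a b : ℝ), a < b → ∀ P : Polynomial ℝ, ∃ x ∈ Set.Ioo a b, η x ≠ P.eval x

open Filter Topology

section Polynomial

open Polynomial

/-- Every real polynomial of degree less than `n` has an antiderivative of degree less than `n + 1`. -/
theorem Polynomial.exists_derivative_eq (P : ℝ[X]) (n : ℕ) (hP : P.degree < n) :
    ∃ Q : ℝ[X], derivative Q = P ∧ Q.degree < (n + 1 : ℕ) := by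
  refine ⟨∑ i ∈ Finset.range n, C (P.coeff i / (i + 1)) * X ^ (i + 1), ?_, ?_⟩
  · have hn : P.natDegree < n ∨ P = 0 := by
      by_cases h : P = 0
      · exact Or.inr h
      · exact Or.inl ((natDegree_lt_iff_degree_lt h).2 hP)
    rw [derivative_sum]
    have hterm : ∀ i : ℕ, derivative (C (P.coeff i / (i + 1)) * X ^ (i + 1)) =
        C (P.coeff i) * X ^ i := fun i => by
      have hi : (i : ℝ) + 1 ≠ 0 := by positivity
      rw [derivative_C_mul_X_pow]
      push_cast
      rw [div_mul_cancel₀ _ hi]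
    simp_rw [hterm]
    rcases hn with h | h
    · exact (P.as_sum_range_C_mul_X_pow' h).symm
    · simp [h]
  · refine (degree_sum_le _ _).trans_lt ((Finset.sup_lt_iff (WithBot.bot_lt_coe _)).2 ?_)
    intro i hi
    refine (degree_C_mul_X_pow_le _ _).trans_lt ?_
    exact_mod_cast Nat.succ_lt_succ (Finset.mem_range.1 hi)

/-- A smooth function whose `k`-th derivative vanishes is a polynomial of degree less than `k`. -/
theorem exists_polynomial_of_iteratedDeriv_eq_zero (k : ℕ) (g : ℝ → ℝ)
    (hg : ContDiff ℝ (⊤ : ℕ∞) g) (h : ∀ x, iteratedDeriv k g x = 0) :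
    ∃ P : ℝ[X], P.degree < k ∧ ∀ x, g x = P.eval x := by
  induction k generalizing g with
  | zero => exact ⟨0, by simp, by simpa using h⟩
  | succ k ih =>
    obtain ⟨P, hPk, hP⟩ := ih (deriv g) ((contDiff_infty_iff_deriv.1 hg).2)
      (by simpa [iteratedDeriv_succ'] using h)
    obtain ⟨Q, rfl, hQ⟩ := P.exists_derivative_eq k hPk
    have hdg : Differentiable ℝ g := (contDiff_infty_iff_deriv.1 hg).1
    have hconst : ∀ x, g x - Q.eval x = g 0 - Q.eval 0 := fun x =>
      is_const_of_deriv_eq_zero (f := fun y => g y - Q.eval y) (hdg.sub Q.differentiable)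
        (fun y => by rw [deriv_fun_sub (hdg y) Q.differentiableAt, hP, Polynomial.deriv, sub_self]) x 0
    refine ⟨Q + C (g 0 - Q.eval 0), ?_, fun x => ?_⟩
    · refine (degree_add_le _ _).trans_lt (max_lt hQ (degree_C_le.trans_lt ?_))
      exact_mod_cast Nat.succ_pos k
    · rw [eval_add, eval_C, ← hconst x]; ring

/-- Polynomial functions of degree less than `k` are closed under pointwise limits. -/
theorem exists_polynomial_of_tendsto {ι : Type*} {l : Filter ι} [l.NeBot] (k : ℕ)
    (P : ι → ℝ[X]) (hP : ∀ i, (P i).degree < k) (f : ℝ → ℝ)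
    (h : ∀ x, Tendsto (fun i => (P i).eval x) l (𝓝 (f x))) :
    ∃ Q : ℝ[X], ∀ x, f x = Q.eval x := by
  let v : ℕ → ℝ := fun i => i
  have hv : Set.InjOn v (Finset.range k) := Nat.cast_injective.injOn
  have hPi : ∀ i x, (P i).eval x =
      ∑ j ∈ Finset.range k, (P i).eval (v j) * (Lagrange.basis (Finset.range k) v j).eval x := by
    intro i x
    conv_lhs => rw [Lagrange.eq_interpolate (f := P i) hv (by simpa using hP i)]
    simp only [Lagrange.interpolate_apply, eval_finsetSum, eval_mul, eval_C]
  refine ⟨Lagrange.interpolate (Finset.range k) v fun j => f (v j), fun x => ?_⟩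
  refine tendsto_nhds_unique (h x) ?_
  rw [funext fun i => hPi i x]
  simp only [Lagrange.interpolate_apply, eval_finsetSum, eval_mul, eval_C]
  exact tendsto_finsetSum _ fun j _ => (h (v j)).mul_const _

end Polynomial

section Ridge

variable {X : Type*} [TopologicalSpace X]

/-- The function `x ↦ g (w * u x + b)`. -/
noncomputable def ridge (g : C(ℝ, ℝ)) (u : C(X, ℝ)) (w b : ℝ) : C(X, ℝ) :=
  g.comp (w • u + ContinuousMap.const X b)

@[simp]
theorem ridge_apply (g : C(ℝ, ℝ)) (u : C(X, ℝ)) (w b : ℝ) (x : X) :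
    ridge g u w b x = g (w * u x + b) := rfl

variable [CompactSpace X]

theorem continuous_ridge (g : C(ℝ, ℝ)) (u : C(X, ℝ)) :
    Continuous fun z : ℝ × ℝ => ridge g u z.1 z.2 := by
  refine (ContinuousMap.continuous_postcomp g).comp ?_
  exact (continuous_fst.smul continuous_const).add
    (ContinuousMap.continuous_const'.comp continuous_snd)

theorem hasDerivAt_ridge (g g' : C(ℝ, ℝ)) (hg : ∀ x, HasDerivAt g (g' x) x) (u : C(X, ℝ))
    (w b : ℝ) : HasDerivAt (fun w => ridge g u w b) (u * ridge g' u w b) w := by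
  have hcont : Continuous fun s : ℝ => u * ridge g' u s b :=
    continuous_const.mul ((continuous_ridge g' u).comp (continuous_id.prodMk continuous_const))
  have heq : (fun w => ridge g u w b) =
      fun w => ridge g u 0 b + ∫ s in (0 : ℝ)..w, u * ridge g' u s b := by
    funext t
    ext x
    have h1 : (∫ s in (0 : ℝ)..t, u * ridge g' u s b) x =
        ∫ s in (0 : ℝ)..t, u x * g' (s * u x + b) :=
      ((ContinuousMap.evalCLM ℝ x).intervalIntegral_comp_comm
        (hcont.intervalIntegrable 0 t)).symm
    have h2 : ∫ s in (0 : ℝ)..t, u x * g' (s * u x + b) =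
        g (t * u x + b) - g (0 * u x + b) := by
      refine intervalIntegral.integral_eq_sub_of_hasDerivAt (f := fun s => g (s * u x + b))
        (fun s _ => ?_) (Continuous.intervalIntegrable (by fun_prop) _ _)
      have := (hg (s * u x + b)).comp s (((hasDerivAt_id s).mul_const (u x)).add_const b)
      simpa [mul_comm, Function.comp_def] using this
    rw [ContinuousMap.add_apply, h1, h2]
    simp
  rw [heq]
  exact (intervalIntegral.integral_hasDerivAt_right (hcont.intervalIntegrable 0 w)
    (hcont.stronglyMeasurableAtFilter _ _) hcont.continuousAt).const_add _

theorem map_mul_ridge_deriv_eq_zero (Λ : C(X, ℝ) →L[ℝ] ℝ) (g g' : C(ℝ, ℝ))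
    (hg : ∀ x, HasDerivAt g (g' x) x) (u v : C(X, ℝ))
    (h : ∀ w b, Λ (v * ridge g u w b) = 0) (w b : ℝ) :
    Λ (v * u * ridge g' u w b) = 0 := by
  have hd : HasDerivAt (fun w => Λ (v * ridge g u w b)) (Λ (v * (u * ridge g' u w b))) w :=
    Λ.hasFDerivAt.comp_hasDerivAt w ((hasDerivAt_ridge g g' hg u w b).const_mul v)
  simp_rw [h] at hd
  rw [mul_assoc]
  exact hd.unique (hasDerivAt_const w 0)

theorem map_pow_mul_ridge_iteratedDeriv_eq_zero (Λ : C(X, ℝ) →L[ℝ] ℝ) (g : ℝ → ℝ)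
    (hg : ContDiff ℝ (⊤ : ℕ∞) g) (u : C(X, ℝ))
    (h : ∀ w b, Λ (ridge ⟨g, hg.continuous⟩ u w b) = 0) (k : ℕ) (w b : ℝ) :
    Λ (u ^ k * ridge ⟨iteratedDeriv k g,
      hg.continuous_iteratedDeriv k (mod_cast le_top)⟩ u w b) = 0 := by
  induction k generalizing w b with
  | zero => simpa [iteratedDeriv_zero] using h w b
  | succ k ih =>
    rw [pow_succ]
    refine map_mul_ridge_deriv_eq_zero Λ _ _ (fun x => ?_) u (u ^ k) ih w b
    have := (hg.differentiable_iteratedDeriv k (mod_cast WithTop.coe_lt_top _) x).hasDerivAt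
    simpa [iteratedDeriv_succ] using this

open Convolution in
/-- Vanishing on ridge functions passes from `η` to its mollifications. -/
theorem map_ridge_convolution_eq_zero (Λ : C(X, ℝ) →L[ℝ] ℝ) (η : C(ℝ, ℝ)) (ψ : ℝ → ℝ)
    (hψ : Continuous ψ) (hψc : HasCompactSupport ψ) (u : C(X, ℝ))
    (h : ∀ w b, Λ (ridge η u w b) = 0) (g : C(ℝ, ℝ))
    (hg : ⇑g = (ψ ⋆[ContinuousLinearMap.lsmul ℝ ℝ, volume] η)) (w b : ℝ) :
    Λ (ridge g u w b) = 0 := by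
  have hcont : Continuous fun t : ℝ => ψ t • ridge η u w (b - t) :=
    hψ.smul ((continuous_ridge η u).comp (by fun_prop : Continuous fun t : ℝ => (w, b - t)))
  have hint : Integrable (fun t : ℝ => ψ t • ridge η u w (b - t)) :=
    hcont.integrable_of_hasCompactSupport hψc.smul_right
  have heq : ridge g u w b = ∫ t, ψ t • ridge η u w (b - t) := by
    ext x
    rw [ContinuousMap.integral_apply hint, ridge_apply, hg, convolution_def]
    simp [add_sub_assoc]
  rw [heq, ← Λ.integral_comp_comm hint]
  simp [h]

/-- A functional vanishing on all functions `x ↦ η (w * u x + b)`, with `η` not a polynomial, vanishes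
on all powers of `u`. -/
theorem map_pow_eq_zero (Λ : C(X, ℝ) →L[ℝ] ℝ) (η : C(ℝ, ℝ))
    (hη : ∀ P : Polynomial ℝ, ∃ x, η x ≠ P.eval x) (u : C(X, ℝ))
    (h : ∀ w b, Λ (ridge η u w b) = 0) (k : ℕ) : Λ (u ^ k) = 0 := by
  by_contra hk
  let φ : ℕ → ContDiffBump (0 : ℝ) := fun n =>
    ⟨1 / (n + 1 : ℝ) / 2, 1 / (n + 1 : ℝ), by positivity, half_lt_self (by positivity)⟩
  have hφ : Tendsto (fun n => (φ n).rOut) atTop (𝓝 0) := tendsto_one_div_add_atTop_nhds_zero_nat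
  let g : ℕ → ℝ → ℝ := fun n =>
    convolution ((φ n).normed volume) η (ContinuousLinearMap.lsmul ℝ ℝ) volume
  have hg : ∀ n, ContDiff ℝ (⊤ : ℕ∞) (g n) := fun n =>
    (φ n).hasCompactSupport_normed.contDiff_convolution_left _ (φ n).contDiff_normed
      η.continuous.locallyIntegrable
  have hpoly : ∀ n, ∃ P : Polynomial ℝ, P.degree < k ∧ ∀ x, g n x = P.eval x := by
    intro n
    refine exists_polynomial_of_iteratedDeriv_eq_zero k (g n) (hg n) fun b => ?_
    have h0 := map_pow_mul_ridge_iteratedDeriv_eq_zero Λ (g n) (hg n) u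
      (map_ridge_convolution_eq_zero Λ η _ (φ n).continuous_normed (φ n).hasCompactSupport_normed
        u h ⟨g n, (hg n).continuous⟩ rfl) k 0 b
    have heq : u ^ k * ridge ⟨iteratedDeriv k (g n),
        (hg n).continuous_iteratedDeriv k (mod_cast le_top)⟩ u 0 b =
        iteratedDeriv k (g n) b • u ^ k := by
      ext x
      simp [mul_comm]
    rw [heq, map_smul, smul_eq_mul] at h0
    exact (mul_eq_zero.1 h0).resolve_right hk
  choose P hPk hP using hpoly
  obtain ⟨Q, hQ⟩ := exists_polynomial_of_tendsto k P hPk η fun x => by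
    simp_rw [← hP]
    exact ContDiffBump.convolution_tendsto_right_of_continuous hφ η.continuous x
  obtain ⟨x, hx⟩ := hη Q
  exact hx (hQ x)

theorem map_exp_eq_zero (Λ : C(X, ℝ) →L[ℝ] ℝ) (u : C(X, ℝ)) (h : ∀ k, Λ (u ^ k) = 0) :
    Λ (NormedSpace.exp u) = 0 := by
  have := (NormedSpace.exp_series_hasSum_exp' (𝕂 := ℝ) u).mapL Λ
  simp only [map_smul, h, smul_zero] at this
  exact this.unique hasSum_zero

/-- A functional vanishing on the exponentials of a point-separating additive family of continuous
functions vanishes. -/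
theorem eq_zero_of_map_exp_eq_zero {M : Type*} [AddMonoid M] (Λ : C(X, ℝ) →L[ℝ] ℝ)
    (U : M →+ C(X, ℝ)) (hU : ∀ x y : X, x ≠ y → ∃ a, U a x ≠ U a y)
    (h : ∀ a, Λ (NormedSpace.exp (U a)) = 0) : Λ = 0 := by
  let S : Submonoid C(X, ℝ) :=
    { carrier := Set.range fun a => NormedSpace.exp (U a)
      one_mem' := ⟨0, by simp⟩
      mul_mem' := by
        rintro _ _ ⟨a, rfl⟩ ⟨b, rfl⟩
        exact ⟨a + b, by simp [NormedSpace.exp_add]⟩ }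
  let A := Algebra.adjoin ℝ (S : Set C(X, ℝ))
  have hsep : A.SeparatesPoints := by
    intro x y hxy
    obtain ⟨a, ha⟩ := hU x y hxy
    have hexp : ∀ z, (NormedSpace.exp (U a) : C(X, ℝ)) z = Real.exp (U a z) := fun z => by
      rw [Real.exp_eq_exp_ℝ]
      exact NormedSpace.map_exp (ContinuousMap.evalAlgHom ℝ ℝ z)
        (continuous_eval_const z) (U a)
    refine ⟨_, ⟨NormedSpace.exp (U a), Algebra.subset_adjoin ⟨a, rfl⟩, rfl⟩, ?_⟩
    simpa [hexp] using ha
  have htop := ContinuousMap.subalgebra_topologicalClosure_eq_top_of_separatesPoints A hsep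
  have hker : (A : Set C(X, ℝ)) ⊆ {f | Λ f = 0} := by
    have hle : Subalgebra.toSubmodule A ≤ LinearMap.ker Λ.toLinearMap := by
      rw [Algebra.adjoin_eq_span, Submonoid.closure_eq, Submodule.span_le]
      rintro _ ⟨a, rfl⟩
      exact h a
    exact fun f hf => hle hf
  ext f
  have hf : f ∈ A.topologicalClosure := htop ▸ Algebra.mem_top
  exact closure_minimal hker (isClosed_eq Λ.continuous continuous_const) hf

end Ridge

section VectorValued

variable {X : Type*} [TopologicalSpace X]
  {G : Type*} [NormedAddCommGroup G] [NormedSpace ℝ G]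

/-- Multiplication of scalar functions by a fixed vector, as a continuous linear map. -/
noncomputable def smulConst (v : G) : C(X, ℝ) →L[ℝ] C(X, G) :=
  (ContinuousLinearMap.toSpanSingleton ℝ v).compLeftContinuous ℝ X

@[simp]
theorem smulConst_apply (v : G) (h : C(X, ℝ)) (x : X) : smulConst v h x = h x • v := rfl

variable [CompactSpace X]

/-- Sums of products of scalar functions and vectors are dense in `C(X, G)`. -/
theorem exists_norm_sub_sum_smulConst_lt [T2Space X] (F : C(X, G)) {ε : ℝ} (hε : 0 < ε) :
    ∃ (t : Finset X) (h : t → C(X, ℝ)) (v : t → G), ‖F - ∑ i, smulConst (v i) (h i)‖ < ε := by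
  obtain ⟨t, ht⟩ := isCompact_univ.elim_finite_subcover
    (fun y : X => {x | F y ∈ Metric.ball (F x) ε})
    (fun y => by
      simp only [Metric.mem_ball]
      exact isOpen_lt (continuous_const.dist F.continuous) continuous_const)
    (fun x _ => Set.mem_iUnion.2 ⟨x, Metric.mem_ball_self hε⟩)
  obtain ⟨f, hf⟩ := PartitionOfUnity.exists_isSubordinate isClosed_univ
    (fun y : t => {x | F y ∈ Metric.ball (F x) ε})
    (fun y => by
      simp only [Metric.mem_ball]
      exact isOpen_lt (continuous_const.dist F.continuous) continuous_const)
    (by simpa [Set.iUnion_subtype] using ht)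
  refine ⟨t, fun i => f i, fun i => F i, (ContinuousMap.norm_lt_iff _ hε).2 fun x => ?_⟩
  have hx := f.finsum_smul_mem_convex (g := fun i _ => F i) (t := Metric.ball (F x) ε)
    (Set.mem_univ x) (fun i hi => hf i (subset_tsupport _ hi)) (convex_ball _ _)
  rw [finsum_eq_sum_of_fintype, mem_ball_iff_norm'] at hx
  simpa [ContinuousMap.sum_apply] using hx

/-- A vector killed by every functional that vanishes on `W` lies in the closure of `W`. -/
theorem Submodule.mem_topologicalClosure_of_forall_dual {V : Type*} [NormedAddCommGroup V]
    [NormedSpace ℝ V] (W : Submodule ℝ V) (x : V)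
    (h : ∀ Λ : V →L[ℝ] ℝ, (∀ y ∈ W, Λ y = 0) → Λ x = 0) : x ∈ W.topologicalClosure := by
  by_contra hx
  obtain ⟨Λ, s, hs, hsx⟩ := geometric_hahn_banach_closed_point W.topologicalClosure.convex
    W.isClosed_topologicalClosure hx
  have h0 : 0 < s := by simpa using hs 0 (zero_mem _)
  refine (h0.trans hsx).ne' (h Λ fun y hy => ?_)
  by_contra hy0
  have := hs ((s / Λ y) • y) (W.le_topologicalClosure (W.smul_mem _ hy))
  simp [div_mul_cancel₀ _ hy0] at this

/-- Density of vector-valued shallow networks in `C(X, G)`, when the feature maps form an additive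
and scaling-stable point-separating family. -/
theorem mem_closure_span_ridge [T2Space X] {M : Type*} [AddCommGroup M] [Module ℝ M]
    (U : M →ₗ[ℝ] C(X, ℝ)) (hU : ∀ x y : X, x ≠ y → ∃ a, U a x ≠ U a y) (η : C(ℝ, ℝ))
    (hη : ∀ P : Polynomial ℝ, ∃ x, η x ≠ P.eval x) (F : C(X, G)) :
    F ∈ (Submodule.span ℝ (Set.range fun z : M × ℝ × G =>
      smulConst z.2.2 (ridge η (U z.1) 1 (-z.2.1)))).topologicalClosure := by
  refine Submodule.mem_topologicalClosure_of_forall_dual _ _ fun Λ hΛ => ?_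
  have hzero : ∀ v : G, Λ ∘L smulConst v = 0 := by
    intro v
    refine eq_zero_of_map_exp_eq_zero _ U.toAddMonoidHom hU fun a => ?_
    refine map_exp_eq_zero _ _ fun k => map_pow_eq_zero _ η hη _ (fun w b => ?_) k
    have heq : ridge η (U a) w b = ridge η (U (w • a)) 1 (- -b) := by
      ext x; simp
    refine Eq.trans ?_ (hΛ _ (Submodule.subset_span ⟨(w • a, -b, v), rfl⟩))
    exact congrArg (fun r => Λ (smulConst v r)) heq
  have hcl : F ∈ closure {f | Λ f = 0} := by
    refine Metric.mem_closure_iff.2 fun ε hε => ?_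
    obtain ⟨t, h, v, hF⟩ := exists_norm_sub_sum_smulConst_lt F hε
    refine ⟨_, ?_, (dist_eq_norm _ _).trans_lt hF⟩
    have : ∀ i, Λ (smulConst (v i) (h i)) = 0 := fun i => DFunLike.congr_fun (hzero (v i)) (h i)
    simp [this]
  rwa [(isClosed_eq Λ.continuous continuous_const).closure_eq] at hcl

end VectorValued

/-- Integration against elements of `L^{p′}` separates the points of `Lᵖ`. -/
theorem MeasureTheory.Lp.exists_integral_mul_ne {Ω : Type*} [MeasurableSpace Ω] {μ : Measure Ω}
    {p p' : ENNReal} (hp : 1 ≤ p) (hp_top : p ≠ ⊤) {f g : Lp ℝ p μ} (hfg : f ≠ g) :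
    ∃ φ : Lp ℝ p' μ, ∫ s, f s * φ s ∂μ ≠ ∫ s, g s * φ s ∂μ := by
  by_contra! hall
  have hint : ∀ h : Lp ℝ p μ, ∀ s, MeasurableSet s → μ s < ⊤ → IntegrableOn h s μ :=
    fun h s hs hμs => integrableOn_Lp_of_measure_ne_top h hp hμs.ne
  have hset : ∀ h : Lp ℝ p μ, ∀ s (hs : MeasurableSet s) (hμs : μ s < ⊤),
      ∫ x, h x * indicatorConstLp p' hs hμs.ne (1 : ℝ) x ∂μ = ∫ x in s, h x ∂μ := by
    intro h s hs hμs
    rw [← integral_indicator hs]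
    refine integral_congr_ae ?_
    filter_upwards [indicatorConstLp_coeFn (p := p') (hs := hs) (hμs := hμs.ne) (c := (1 : ℝ))]
      with x hx
    rw [hx]
    by_cases hxs : x ∈ s <;> simp [hxs]
  apply hfg
  rw [← sub_eq_zero, Lp.eq_zero_iff_ae_eq_zero]
  refine Lp.ae_eq_zero_of_forall_setIntegral_eq_zero _ (zero_lt_one.trans_le hp).ne' hp_top
    (hint _) fun s hs hμs => ?_
  rw [setIntegral_congr_ae (g := fun x => f x - g x) hs
    ((Lp.coeFn_sub f g).mono fun x hx _ => hx), integral_sub (hint f s hs hμs) (hint g s hs hμs),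
    ← hset f s hs hμs, ← hset g s hs hμs, hall, sub_self]

/-- Function-to-function universal approximation between Lebesgue spaces: every
continuous map `𝓕` from a compact subset `E ⊆ Lᵖ(Ω₁, μ₁)` into `L^q(Ω₂, μ₂)` can
be uniformly approximated by shallow networks whose inner weights are given by
integration against functions `φ_j ∈ L^{p′}(Ω₁, μ₁)` and whose coefficients are
functions `g_j ∈ L^q(Ω₂, μ₂)`. -/
theorem function_to_function_UAT
    {Ω₁ : Type*} [MeasurableSpace Ω₁] (μ₁ : Measure Ω₁)
    {Ω₂ : Type*} [MeasurableSpace Ω₂] (μ₂ : Measure Ω₂)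
    (p p' q : ENNReal) [Fact (1 ≤ p)] [Fact (1 ≤ q)]
    (hp : 1 < p) (hp_top : p ≠ ⊤) (hpp' : 1 / p + 1 / p' = 1)
    (hq : 1 ≤ q) (hq_top : q ≠ ⊤)
    (E : Set (Lp ℝ p μ₁)) (hE : IsCompact E) (hEne : E.Nonempty)
    (η : ℝ → ℝ) (hη : Continuous η) (hηpoly : NotPolynomialOnAnyInterval η)
    (𝓕 : Lp ℝ p μ₁ → Lp ℝ q μ₂) (h𝓕 : ContinuousOn 𝓕 E)
    (ε : ℝ) (hε : 0 < ε) :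
    ∃ (m : ℕ) (φ : Fin m → Lp ℝ p' μ₁) (θ : Fin m → ℝ) (g : Fin m → Lp ℝ q μ₂),
      ∀ f ∈ E,
        ‖𝓕 f - ∑ j, η ((∫ s, f s * φ j s ∂μ₁) - θ j) • g j‖ < ε := by
  have : ENNReal.HolderConjugate p p' :=
    ENNReal.holderConjugate_iff.2 (by simpa [one_div] using hpp')
  have : Fact (1 ≤ p') := ⟨ENNReal.HolderConjugate.one_le p' p⟩
  have : CompactSpace E := isCompact_iff_compactSpace.1 hE
  let B : Lp ℝ p μ₁ →L[ℝ] Lp ℝ p' μ₁ →L[ℝ] ℝ := (ContinuousLinearMap.mul ℝ ℝ).lpPairing μ₁ p p'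
  have hB : ∀ f φ, B f φ = ∫ s, f s * φ s ∂μ₁ := fun f φ =>
    (ContinuousLinearMap.mul ℝ ℝ).lpPairing_eq_integral f φ
  let U : Lp ℝ p' μ₁ →ₗ[ℝ] C(E, ℝ) :=
    { toFun := fun φ => ⟨fun f => B f φ, by fun_prop⟩
      map_add' := fun φ ψ => by ext f; simp
      map_smul' := fun c φ => by ext f; simp }
  have hU : ∀ f g : E, f ≠ g → ∃ φ, U φ f ≠ U φ g := fun f g hfg => by
    obtain ⟨φ, hφ⟩ := Lp.exists_integral_mul_ne (p' := p') hp.le hp_top (Subtype.coe_injective.ne hfg)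
    exact ⟨φ, by simpa [U, hB] using hφ⟩
  have hmem := mem_closure_span_ridge U hU ⟨η, hη⟩
    (fun P => (hηpoly 0 1 one_pos P).imp fun _ h => h.2) ⟨E.domRestrict 𝓕, h𝓕.domRestrict⟩
  obtain ⟨N, hN, hdist⟩ := Metric.mem_closure_iff.1 hmem ε hε
  obtain ⟨m, c, z, rfl⟩ := Submodule.mem_span_set'.1 hN
  choose y hy using fun j => (z j).2
  refine ⟨m, fun j => (y j).1, fun j => (y j).2.1, fun j => c j • (y j).2.2, fun f hf => ?_⟩
  refine Eq.trans_lt ?_ ((ContinuousMap.dist_apply_le_dist ⟨f, hf⟩).trans_lt hdist)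
  rw [dist_eq_norm, ContinuousMap.sum_apply]
  congr 2
  refine Finset.sum_congr rfl fun j _ => ?_
  rw [ContinuousMap.smul_apply, ← hy j]
  simp [U, hB, smul_comm (c j), sub_eq_add_neg]
end

section
/- Let Ω ⊆ ℝ^d be a bounded domain, let 1 < p < ∞ with conjugate exponent p′, and let 1 ≤ q < ∞. Let K : closure(Ω) × closure(Ω) → ℝ be continuous, and define the integral operator 𝓕 : Lᵖ(Ω) → L^q(Ω) by (𝓕f)(x) = ∫_Ω K(x, s) f(s) ds. Let E ⊆ Lᵖ(Ω) be a nonempty compact subset and let η : ℝ → ℝ be continuous and not a polynomial on any nonempty open interval. Then for every ε > 0 there exist m ∈ ℕ, φ_1,…,φ_m ∈ L^{p′}(Ω), reals θ_1,…,θ_m, and g_1,…,g_m ∈ L^q(Ω) such that sup_{f ∈ E} ‖𝓕(f) − Σ_{j=1}^m η(∫_Ω f(s) φ_j(s) ds − θ_j) • g_j‖_{L^q} < ε. -/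
open MeasureTheory Bornology

/-- The neurons `t ↦ η (w t - b)` of a nonconstant continuous activation function approximate the
identity uniformly on bounded intervals. -/
lemma exists_shallow_network_near_id {η : ℝ → ℝ} (hη : Continuous η) {a h : ℝ}
    (hne : η a ≠ η (a + h)) (M : ℝ) {δ : ℝ} (hδ : 0 < δ) :
    ∃ (n : ℕ) (c w b : Fin n → ℝ), ∀ t : ℝ, |t| ≤ M →
      |t - ∑ k, c k * η (w k * t - b k)| < δ := by
  have hh : h ≠ 0 := by
    rintro rfl
    simp at hne
  let neuron : ℝ → ℝ → C(Set.Icc (-M) M, ℝ) := fun w b =>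
    ⟨fun t => η (w * t - b), by fun_prop⟩
  let ident : C(Set.Icc (-M) M, ℝ) := ⟨fun t => t, by fun_prop⟩
  let T : Submodule ℝ C(Set.Icc (-M) M, ℝ) :=
    Submodule.span ℝ (Set.range fun z : ℝ × ℝ => neuron z.1 z.2)
  let S := T.topologicalClosure
  have hneuron : ∀ w b, neuron w b ∈ S := fun w b =>
    T.le_topologicalClosure (Submodule.subset_span ⟨(w, b), rfl⟩)
  have hcont : ∀ w, Continuous fun y : ℝ => neuron w (-(a + h * y)) := fun w =>
    ContinuousMap.continuous_of_continuous_uncurry _ <| by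
      change Continuous fun z : ℝ × Set.Icc (-M) M => η (w * z.2 - -(a + h * z.1))
      fun_prop
  let G : ℝ → C(Set.Icc (-M) M, ℝ) := fun w => ∫ y in (0 : ℝ)..1, neuron w (-(a + h * y))
  have hG : ∀ w, G w ∈ S := by
    intro w
    have : IsProbabilityMeasure (volume.restrict (Set.Ioc (0 : ℝ) 1)) := ⟨by simp⟩
    simp only [G]
    rw [intervalIntegral.integral_of_le zero_le_one]
    refine Convex.integral_mem (s := (S : Set C(Set.Icc (-M) M, ℝ))) S.convex
      T.isClosed_topologicalClosure (Filter.Eventually.of_forall fun y => hneuron _ _) ?_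
    exact ((hcont w).intervalIntegrable 0 1).1
  let N : ℝ → ℝ := fun u => ∫ y in (0 : ℝ)..u, η y
  have hN : ∀ u, HasDerivAt N (η u) u := fun u =>
    intervalIntegral.integral_hasDerivAt_right (hη.intervalIntegrable _ _)
      hη.stronglyMeasurable.stronglyMeasurableAtFilter hη.continuousAt
  let H : ℝ → ℝ := fun u => h⁻¹ * (N (a + h + u) - N (a + u))
  have hGH : ∀ w t, G w t = H (w * t) := by
    intro w t
    have h1 : G w t = ∫ y in (0 : ℝ)..1, η (w * t - -(a + h * y)) :=
      ((ContinuousMap.evalCLM ℝ t).intervalIntegral_comp_comm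
        ((hcont w).intervalIntegrable 0 1)).symm
    have h2 : ∀ y : ℝ, w * t - -(a + h * y) = (a + w * t) + h * y := fun y => by ring
    simp only [h2] at h1
    rw [h1, intervalIntegral.integral_comp_add_mul η hh]
    simp only [H, N, smul_eq_mul]
    rw [intervalIntegral.integral_interval_sub_left (hη.intervalIntegrable _ _)
      (hη.intervalIntegrable _ _)]
    ring_nf
  let c : ℝ := h⁻¹ * (η (a + h) - η a)
  have hc : c ≠ 0 := mul_ne_zero (inv_ne_zero hh) (sub_ne_zero.2 hne.symm)
  have hH : HasDerivAt H c 0 := by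
    have h1 : HasDerivAt (fun u => N (a + h + u)) (η (a + h)) 0 :=
      HasDerivAt.comp_const_add (a + h) 0 (by simpa using hN (a + h))
    have h2 : HasDerivAt (fun u => N (a + u)) (η a) 0 :=
      HasDerivAt.comp_const_add a 0 (by simpa using hN a)
    exact (h1.sub h2).const_mul h⁻¹
  have hident : c • ident ∈ S := by
    suffices c • ident ∈ closure (S : Set C(Set.Icc (-M) M, ℝ)) from
      T.isClosed_topologicalClosure.closure_subset this
    refine Metric.mem_closure_iff.2 fun e he => ?_
    have hM : 0 < |M| + 1 := by positivity
    obtain ⟨r, hr, hball⟩ := Metric.eventually_nhds_iff.1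
      ((hasDerivAt_iff_isLittleO.1 hH).bound (half_pos (div_pos he hM)))
    let w : ℝ := r / 2 / (|M| + 1)
    have hw : 0 < w := by positivity
    refine ⟨w⁻¹ • (G w - G 0), S.smul_mem _ (S.sub_mem (hG w) (hG 0)), ?_⟩
    refine lt_of_le_of_lt ((ContinuousMap.dist_le (half_pos he).le).2 fun t => ?_) (half_lt_self he)
    have ht : |(t : ℝ)| ≤ |M| + 1 := by
      have := abs_le.2 t.2
      have := le_abs_self M
      linarith
    have hwt : |w * t| < r := by
      rw [abs_mul, abs_of_pos hw]
      calc w * |(t : ℝ)| ≤ w * (|M| + 1) := by gcongr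
        _ = r / 2 := by simp only [w]; field_simp
        _ < r := half_lt_self hr
    have key := hball (y := w * t) (by simpa [Real.dist_eq] using hwt)
    simp only [sub_zero, smul_eq_mul, Real.norm_eq_abs] at key
    have heq : (c • ident) t - (w⁻¹ • (G w - G 0)) t
        = -(w⁻¹ * (H (w * t) - H 0 - w * t * c)) := by
      simp only [ContinuousMap.smul_apply, ContinuousMap.sub_apply, hGH, zero_mul, smul_eq_mul]
      change c * (t : ℝ) - _ = _
      field_simp
      ring
    rw [Real.dist_eq, heq, abs_neg, abs_mul, abs_of_pos (inv_pos.2 hw)]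
    calc w⁻¹ * |H (w * t) - H 0 - w * t * c|
        ≤ w⁻¹ * (e / (|M| + 1) / 2 * |w * t|) := by gcongr
      _ = e / (|M| + 1) / 2 * |(t : ℝ)| := by
          rw [abs_mul, abs_of_pos hw]; field_simp
      _ ≤ e / (|M| + 1) / 2 * (|M| + 1) := by gcongr
      _ = e / 2 := by field_simp
  have hident' : ident ∈ S := by
    simpa [smul_smul, hc] using S.smul_mem c⁻¹ hident
  obtain ⟨u, hu, hdist⟩ := Metric.mem_closure_iff.1 hident' δ hδ
  obtain ⟨n, r, g, rfl⟩ := Submodule.mem_span_set'.1 hu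
  choose z hz using fun k => (g k).2
  refine ⟨n, r, fun k => (z k).1, fun k => (z k).2, fun t ht => ?_⟩
  have h1 := (ContinuousMap.dist_apply_le_dist (f := ident) (g := ∑ k, r k • (g k).1)
    ⟨t, abs_le.1 ht⟩).trans_lt hdist
  simp only [← hz] at h1
  simpa [Real.dist_eq, ident, neuron, ContinuousMap.sum_apply] using h1

/-- Continuous partition of unity on a compact set subordinate to finitely many small balls. -/
lemma IsCompact.exists_partition_of_unity_near {α : Type*} [PseudoMetricSpace α] {s : Set α}
    (hs : IsCompact s) {r : ℝ} (hr : 0 < r) :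
    ∃ (t : Finset α) (g : α → α → ℝ), (∀ y ∈ t, y ∈ s) ∧ (∀ y, ContinuousOn (g y) s) ∧
      (∀ y x, 0 ≤ g y x) ∧ (∀ y x, r ≤ dist x y → g y x = 0) ∧
      ∀ x ∈ s, ∑ y ∈ t, g y x = 1 := by
  obtain ⟨t, hts, htf, hcover⟩ := hs.finite_cover_balls hr
  lift t to Finset α using htf
  let b : α → α → ℝ := fun y x => max 0 (r - dist x y)
  have hb : ∀ y x, 0 ≤ b y x := fun y x => le_max_left _ _
  have hpos : ∀ x ∈ s, 0 < ∑ z ∈ t, b z x := by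
    intro x hx
    obtain ⟨y, hy, hxy⟩ := Set.mem_iUnion₂.1 (hcover hx)
    exact Finset.sum_pos' (fun z _ => hb z x)
      ⟨y, hy, lt_max_of_lt_right (sub_pos.2 (Metric.mem_ball.1 hxy))⟩
  refine ⟨t, fun y x => b y x / ∑ z ∈ t, b z x, fun y hy => hts hy, fun y => ?_, fun y x => ?_,
    fun y x hxy => ?_, fun x hx => ?_⟩
  · refine ContinuousOn.div ?_ ?_ fun x hx => (hpos x hx).ne'
    · exact Continuous.continuousOn (by fun_prop)
    · exact Continuous.continuousOn (by fun_prop)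
  · exact div_nonneg (hb y x) (Finset.sum_nonneg fun z _ => hb z x)
  · simp [b, hxy]
  · rw [← Finset.sum_div, div_self (hpos x hx).ne']

lemma ContinuousOn.memLp_restrict_of_isCompact_closure {α : Type*} [TopologicalSpace α]
    [MeasurableSpace α] [OpensMeasurableSpace α] {μ : Measure α}
    {s : Set α} [IsFiniteMeasure (μ.restrict s)] (hs : MeasurableSet s)
    (hsc : IsCompact (closure s)) {f : α → ℝ} (hf : ContinuousOn f (closure s)) (p : ENNReal) :
    MemLp f p (μ.restrict s) := by
  obtain ⟨C, hC⟩ := hsc.exists_bound_of_continuousOn hf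
  refine MemLp.of_bound ((hf.mono subset_closure).aestronglyMeasurable hs) C ?_
  exact (ae_restrict_iff' hs).2 (Filter.Eventually.of_forall fun x hx => hC x (subset_closure hx))

lemma Bornology.IsBounded.exists_integral_norm_le {α : Type*} [MeasurableSpace α] {μ : Measure α}
    [IsFiniteMeasure μ] {p : ENNReal} [hp : Fact (1 ≤ p)] {E : Set (Lp ℝ p μ)}
    (hE : IsBounded E) : ∃ B : ℝ, 0 ≤ B ∧ ∀ f ∈ E, ∫ s, |f s| ∂μ ≤ B := by
  obtain ⟨R, hR, hER⟩ := hE.exists_pos_norm_le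
  let m : ENNReal := μ Set.univ ^ (1 / (1 : ENNReal).toReal - 1 / p.toReal)
  have hpow : 0 ≤ 1 / (1 : ENNReal).toReal - 1 / p.toReal := by
    rcases eq_or_ne p ⊤ with rfl | hp'
    · simp
    · have : 1 ≤ p.toReal := by
        simpa using ENNReal.toReal_mono hp' hp.out
      have := div_le_one_of_le₀ this (by positivity)
      simpa using this
  have hm : m ≠ ⊤ := ENNReal.rpow_ne_top_of_nonneg hpow (measure_ne_top μ _)
  refine ⟨R * m.toReal, by positivity, fun f hf => ?_⟩
  have h1 := eLpNorm_le_eLpNorm_mul_rpow_measure_univ hp.out (Lp.aestronglyMeasurable f)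
  have h2 : ∫ s, |f s| ∂μ = (eLpNorm f 1 μ).toReal := by
    rw [eLpNorm_one_eq_lintegral_enorm]
    exact integral_norm_eq_lintegral_enorm (Lp.aestronglyMeasurable f)
  rw [h2]
  calc (eLpNorm f 1 μ).toReal ≤ (eLpNorm f p μ * m).toReal :=
        ENNReal.toReal_mono (ENNReal.mul_ne_top (Lp.eLpNorm_ne_top f) hm) h1
    _ = ‖f‖ * m.toReal := by rw [ENNReal.toReal_mul, Lp.norm_def]
    _ ≤ R * m.toReal := by gcongr; exact hER f hf

/-- Partition of unity estimate: if each `a y` is close to `A` wherever `g y` is nonzero, and `u y`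
is close to `a y`, then `∑ g y * u y` is close to `A`. -/
lemma abs_sub_sum_mul_le {ι : Type*} (t : Finset ι) (g a u : ι → ℝ) (A δ₁ δ₂ : ℝ)
    (hg : ∀ y ∈ t, 0 ≤ g y) (hsum : ∑ y ∈ t, g y = 1)
    (ha : ∀ y ∈ t, g y ≠ 0 → |A - a y| ≤ δ₁) (hu : ∀ y ∈ t, |a y - u y| ≤ δ₂) :
    |A - ∑ y ∈ t, g y * u y| ≤ δ₁ + δ₂ := by
  have h1 : A - ∑ y ∈ t, g y * u y = ∑ y ∈ t, g y * (A - u y) := by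
    simp_rw [mul_sub]
    rw [Finset.sum_sub_distrib, ← Finset.sum_mul, hsum, one_mul]
  rw [h1]
  calc |∑ y ∈ t, g y * (A - u y)| ≤ ∑ y ∈ t, |g y * (A - u y)| := Finset.abs_sum_le_sum_abs _ _
    _ ≤ ∑ y ∈ t, g y * (δ₁ + δ₂) := by
        refine Finset.sum_le_sum fun y hy => ?_
        rcases eq_or_ne (g y) 0 with h0 | h0
        · simp [h0]
        rw [abs_mul, abs_of_nonneg (hg y hy)]
        refine mul_le_mul_of_nonneg_left ?_ (hg y hy)
        exact (abs_sub_le A (a y) (u y)).trans (add_le_add (ha y hy h0) (hu y hy))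
    _ = δ₁ + δ₂ := by rw [← Finset.sum_mul, hsum, one_mul]

/-- Universal approximation of integral operators: let `Ω ⊆ ℝ^d` be a bounded
domain, `K` a continuous kernel on `closure Ω × closure Ω`, and `𝓕 : Lᵖ(Ω) → L^q(Ω)`
the integral operator `(𝓕 f)(x) = ∫_Ω K(x, s) f(s) ds`. Then `𝓕` can be uniformly
approximated on any compact set `E ⊆ Lᵖ(Ω)` by shallow neural networks. -/
theorem integral_operator_UAT
    (d : ℕ) (Ω : Set (EuclideanSpace ℝ (Fin d)))
    (hΩo : IsOpen Ω) (hΩc : IsConnected Ω) (hΩb : IsBounded Ω)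
    (p p' q : ENNReal) [Fact (1 ≤ p)] [Fact (1 ≤ q)]
    (hp : 1 < p) (hp_top : p ≠ ⊤) (hpp' : 1 / p + 1 / p' = 1)
    (hq : 1 ≤ q) (hq_top : q ≠ ⊤)
    (K : EuclideanSpace ℝ (Fin d) → EuclideanSpace ℝ (Fin d) → ℝ)
    (hK : ContinuousOn (fun z : EuclideanSpace ℝ (Fin d) × EuclideanSpace ℝ (Fin d) =>
      K z.1 z.2) (closure Ω ×ˢ closure Ω))
    (𝓕 : Lp ℝ p (volume.restrict Ω) → Lp ℝ q (volume.restrict Ω))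
    (h𝓕 : ∀ f : Lp ℝ p (volume.restrict Ω),
      (𝓕 f : EuclideanSpace ℝ (Fin d) → ℝ)
        =ᵐ[volume.restrict Ω] fun x => ∫ s, K x s * f s ∂(volume.restrict Ω))
    (E : Set (Lp ℝ p (volume.restrict Ω))) (hE : IsCompact E) (hEne : E.Nonempty)
    (η : ℝ → ℝ) (hη : Continuous η) (hηpoly : NotPolynomialOnAnyInterval η)
    (ε : ℝ) (hε : 0 < ε) :
    ∃ (m : ℕ) (φ : Fin m → Lp ℝ p' (volume.restrict Ω)) (θ : Fin m → ℝ)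
      (g : Fin m → Lp ℝ q (volume.restrict Ω)),
      ∀ f ∈ E,
        ‖𝓕 f - ∑ j, η ((∫ s, f s * φ j s ∂(volume.restrict Ω)) - θ j) • g j‖ < ε := by
  have hfin : IsFiniteMeasure (volume.restrict Ω) := ⟨by
    rw [Measure.restrict_apply_univ]
    exact hΩb.measure_lt_top⟩
  have hΩm : MeasurableSet Ω := hΩo.measurableSet
  have hcpt : IsCompact (closure Ω) := hΩb.isCompact_closure
  have hmem : ∀ {u : EuclideanSpace ℝ (Fin d) → ℝ}, ContinuousOn u (closure Ω) →
      ∀ r : ENNReal, MemLp u r (volume.restrict Ω) := fun hu r =>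
    hu.memLp_restrict_of_isCompact_closure hΩm hcpt r
  have hKx : ∀ x ∈ closure Ω, ContinuousOn (K x) (closure Ω) := fun x hx =>
    hK.comp (f := fun s => (x, s)) (by fun_prop) fun s hs => ⟨hx, hs⟩
  have hf1 : ∀ f : Lp ℝ p (volume.restrict Ω), Integrable f (volume.restrict Ω) := fun f =>
    (Lp.memLp f).integrable hp.le
  obtain ⟨B, hB0, hB⟩ := hE.isBounded.exists_integral_norm_le
  obtain ⟨C, hC⟩ := (hcpt.prod hcpt).exists_bound_of_continuousOn hK
  have hC' : ∀ x ∈ closure Ω, ∀ s ∈ closure Ω, |K x s| ≤ C := fun x hx s hs => hC (x, s) ⟨hx, hs⟩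
  have hKf : ∀ x ∈ closure Ω, ∀ f : Lp ℝ p (volume.restrict Ω),
      Integrable (fun s => K x s * f s) (volume.restrict Ω) := by
    intro x hx f
    refine (hf1 f).bdd_mul (c := C) (hmem (hKx x hx) 1).1 ?_
    exact (ae_restrict_iff' hΩm).2 (Filter.Eventually.of_forall fun s hs =>
      hC' x hx s (subset_closure hs))
  have hdiff : ∀ (f : Lp ℝ p (volume.restrict Ω)) (k : EuclideanSpace ℝ (Fin d) → ℝ) (D : ℝ),
      (∀ s ∈ Ω, |k s| ≤ D) →
      |∫ s, k s * f s ∂(volume.restrict Ω)| ≤ D * ∫ s, |f s| ∂(volume.restrict Ω) := by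
    intro f k D hD
    rw [← integral_const_mul, ← Real.norm_eq_abs]
    refine norm_integral_le_of_norm_le ((hf1 f).norm.const_mul D) ?_
    refine (ae_restrict_iff' hΩm).2 (Filter.Eventually.of_forall fun s hs => ?_)
    rw [norm_mul]
    exact mul_le_mul_of_nonneg_right (hD s hs) (norm_nonneg _)
  obtain ⟨x₀, hx₀⟩ := hΩc.nonempty
  have hC0 : 0 ≤ C := (abs_nonneg _).trans (hC' x₀ (subset_closure hx₀) x₀ (subset_closure hx₀))
  let V : ℝ := (measureUnivNNReal (volume.restrict Ω) : ℝ) ^ q.toReal⁻¹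
  have hV : 0 ≤ V := by positivity
  let δ : ℝ := ε / (2 * (V + 1))
  have hδ : 0 < δ := by positivity
  let δ' : ℝ := δ / (B + 1)
  have hδ' : 0 < δ' := by positivity
  obtain ⟨r, hr, hunif⟩ := Metric.uniformContinuousOn_iff.1
    ((hcpt.prod hcpt).uniformContinuousOn_of_continuous hK) δ' hδ'
  obtain ⟨t, g, hts, hgc, hg0, hgr, hg1⟩ := hcpt.exists_partition_of_unity_near hr
  obtain ⟨y, -, hy⟩ := hηpoly 0 1 one_pos (Polynomial.C (η 0))
  obtain ⟨n, c, w, b, hnet⟩ := exists_shallow_network_near_id hη (a := 0) (h := y)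
    (by simpa using hy.symm) (C * B) hδ
  let e := Fintype.equivFin (t × Fin n)
  let φ : t × Fin n → Lp ℝ p' (volume.restrict Ω) := fun z =>
    w z.2 • (hmem (hKx z.1 (hts z.1 z.1.2)) p').toLp
  let G : t × Fin n → Lp ℝ q (volume.restrict Ω) := fun z => c z.2 • (hmem (hgc z.1) q).toLp
  refine ⟨_, fun j => φ (e.symm j), fun j => b (e.symm j).2, fun j => G (e.symm j),
    fun f hf => ?_⟩
  rw [e.symm.sum_comp fun z => η ((∫ s, f s * φ z s ∂(volume.restrict Ω)) - b z.2) • G z,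
    Fintype.sum_prod_type]
  let L : EuclideanSpace ℝ (Fin d) → ℝ := fun x => ∫ s, K x s * f s ∂(volume.restrict Ω)
  have hφ : ∀ z : t × Fin n, ∫ s, f s * φ z s ∂(volume.restrict Ω) = w z.2 * L z.1 := by
    intro z
    rw [← integral_const_mul]
    refine integral_congr_ae ?_
    filter_upwards [Lp.coeFn_smul (w z.2) (hmem (hKx z.1 (hts z.1 z.1.2)) p').toLp,
      (hmem (hKx z.1 (hts z.1 z.1.2)) p').coeFn_toLp] with s h1 h2
    simp only [φ, h1, Pi.smul_apply, h2, smul_eq_mul]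
    ring
  simp only [hφ]
  have hsum : ∑ y : t, ∑ k, η (w k * L y - b k) • G (y, k)
      = ∑ y : t, (∑ k, c k * η (w k * L y - b k)) • (hmem (hgc y) q).toLp := by
    refine Finset.sum_congr rfl fun y _ => ?_
    rw [Finset.sum_smul]
    refine Finset.sum_congr rfl fun k _ => ?_
    simp only [G, smul_smul, mul_comm]
  rw [hsum]
  have hL : ∀ y : t, |L y| ≤ C * B := fun y =>
    (hdiff f (K y) C fun s hs => hC' y (hts y y.2) s (subset_closure hs)).trans
      (mul_le_mul_of_nonneg_left (hB f hf) hC0)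
  have hbound : ∀ᵐ x ∂(volume.restrict Ω), ‖(𝓕 f - ∑ y : t, (∑ k, c k * η (w k * L y - b k)) •
      (hmem (hgc y) q).toLp : Lp ℝ q (volume.restrict Ω)) x‖ ≤ δ + δ := by
    have hsm : ∀ᵐ x ∂(volume.restrict Ω), ∀ y : t, ((∑ k, c k * η (w k * L y - b k)) •
        (hmem (hgc y) q).toLp : Lp ℝ q (volume.restrict Ω)) x
          = g y x * ∑ k, c k * η (w k * L y - b k) := by
      refine ae_all_iff.2 fun y => ?_
      filter_upwards [Lp.coeFn_smul (∑ k, c k * η (w k * L y - b k)) (hmem (hgc y) q).toLp,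
        (hmem (hgc y) q).coeFn_toLp] with x h1 h2
      rw [h1, Pi.smul_apply, h2, smul_eq_mul, mul_comm]
    filter_upwards [Lp.coeFn_sub (𝓕 f) (∑ y : t, (∑ k, c k * η (w k * L y - b k)) •
      (hmem (hgc y) q).toLp), h𝓕 f, Lp.coeFn_finsetSum Finset.univ fun y : t =>
      (∑ k, c k * η (w k * L y - b k)) • (hmem (hgc y) q).toLp, hsm,
      ae_restrict_mem hΩm] with x h1 h2 h3 h4 hx
    rw [h1, Pi.sub_apply, h2, h3, Finset.sum_apply, Finset.sum_congr rfl fun y _ => h4 y]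
    have hxc := subset_closure hx
    refine abs_sub_sum_mul_le Finset.univ (fun y : t => g y x) (fun y : t => L y) _ _ _ _
      (fun y _ => hg0 y x) ?_ (fun y _ hy => ?_) fun y _ => (hnet _ (hL y)).le
    · rw [← hg1 x hxc]
      exact Finset.sum_coe_sort t fun y => g y x
    · have hxy : dist x y < r := not_le.1 fun h => hy (hgr y x h)
      simp only [L]
      rw [← integral_sub (hKf x hxc f) (hKf y (hts y y.2) f)]
      simp only [← sub_mul]
      refine (hdiff f (fun s => K x s - K y s) δ' fun s hs => ?_).trans ?_
      · have hsc := subset_closure hs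
        refine (hunif (x, s) ⟨hxc, hsc⟩ (y, s) ⟨hts y y.2, hsc⟩ ?_).le
        simpa [Prod.dist_eq, hr] using hxy
      · calc δ' * ∫ s, |f s| ∂(volume.restrict Ω) ≤ δ' * (B + 1) := by
              gcongr
              linarith [hB f hf]
          _ = δ := by simp only [δ']; field_simp
  refine (Lp.norm_le_of_ae_bound (by positivity) hbound).trans_lt ?_
  change V * (δ + δ) < ε
  have : V * (δ + δ) = V / (V + 1) * ε := by simp only [δ]; field_simp; ring
  rw [this]
  exact mul_lt_of_lt_one_left hε ((div_lt_one (by positivity)).2 (by linarith))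
end
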